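/- Let κ_A, κ_B, κ_C, κ_W ≥ 0, γ > 0 satisfy K := 4(1/γ - κ_W) - (κ_B + κ_C)² > 0, and let p > 2. Then the real quadratic form ℰ(x,y,z) = x² + (p-2)y² + (1/γ - κ_W)z² - 2(p-2)κ_A xy - (κ_B + κ_C)xz - κ_C(p-2)yz is positive semidefinite on ℝ³ if and only if (p-2) ≤ κ_A^{-2} (when κ_A ≠ 0) and K - (p-2)(κ_C² + 4(1/γ - κ_W)κ_A² + 2κ_A κ_C(κ_B + κ_C)) ≥ 0. -/

import Mathlib

/-- Characterization of the positive semidefiniteness of the quadratic form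
`ℰ(x,y,z) = x² + (p-2)y² + (1/γ - κ_W)z² - 2(p-2)κ_A xy - (κ_B + κ_C)xz - κ_C(p-2)yz`. -/
theorem stmt6 (κA κB κC κW γ p : ℝ) (hκA : 0 ≤ κA) (hκB : 0 ≤ κB) (hκC : 0 ≤ κC)
    (hκW : 0 ≤ κW) (hγ : 0 < γ) (hK : 0 < 4 * (1 / γ - κW) - (κB + κC) ^ 2) (hp : 2 < p) :
    (∀ x y z : ℝ,
        0 ≤ x ^ 2 + (p - 2) * y ^ 2 + (1 / γ - κW) * z ^ 2 - 2 * (p - 2) * κA * x * y -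
            (κB + κC) * x * z - κC * (p - 2) * y * z) ↔
      ((κA ≠ 0 → p - 2 ≤ (κA ^ 2)⁻¹) ∧
        0 ≤ (4 * (1 / γ - κW) - (κB + κC) ^ 2) -
            (p - 2) * (κC ^ 2 + 4 * (1 / γ - κW) * κA ^ 2 + 2 * κA * κC * (κB + κC))) := by
  have hq : 0 < p - 2 := by linarith
  generalize p - 2 = q at *
  generalize 1 / γ - κW = w at *
  generalize κB + κC = s at *
  generalize hKK : 4 * w - s ^ 2 = K at *
  have hw : w = (K + s ^ 2) / 4 := by linarith
  have key : ∀ x y z : ℝ, K * (x ^ 2 + q * y ^ 2 + w * z ^ 2 - 2 * q * κA * x * y -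
      s * x * z - κC * q * y * z) = K * (x - q * κA * y - s * z / 2) ^ 2
      + (K * z / 2 - q * (κC + κA * s) * y) ^ 2
      + q * (K - q * (κC ^ 2 + 4 * w * κA ^ 2 + 2 * κA * κC * s)) * y ^ 2 := by
    intro x y z
    rw [hw]
    ring
  constructor
  · intro h
    constructor
    · intro ha
      have ha2 : 0 < κA ^ 2 := by positivity
      have h1 := h (q * κA) 1 0
      have h2 : 0 ≤ q * (1 - q * κA ^ 2) := by nlinarith
      have h3 := nonneg_of_mul_nonneg_right h2 hq
      rw [← one_div, le_div_iff₀ ha2]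
      linarith
    · have h1 := h (q * κA + s * (2 * q * (κC + κA * s) / K) / 2) 1
        (2 * q * (κC + κA * s) / K)
      have h2 := mul_nonneg hK.le h1
      rw [key] at h2
      have e1 : K * (2 * q * (κC + κA * s) / K) / 2 - q * (κC + κA * s) * 1 = 0 := by
        rw [mul_div_cancel₀ _ hK.ne']
        ring
      rw [e1] at h2
      have h3 : 0 ≤ q * (K - q * (κC ^ 2 + 4 * w * κA ^ 2 + 2 * κA * κC * s)) := by
        exact le_of_le_of_eq h2 (by ring)
      exact nonneg_of_mul_nonneg_right h3 hq
  · rintro ⟨-, hD⟩ x y z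
    refine nonneg_of_mul_nonneg_right (a := K) ?_ hK
    rw [key]
    have := mul_nonneg hq.le hD
    positivity
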